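/- Let w' be a minimal non palindrome pair over {0,1} of length at least 7 with an internal maximum block, and let w be the word obtained from w' by deleting one letter from that internal maximum block. Then w is either a minimal non palindrome pair, or w is of the form 0 1^n 0 1^n 0 or 1 0^n 1 0^n 1 for some integer n ≥ 1. -/

import Mathlib

/-- A word over {0,1} (represented as `List Bool`) is a *palindrome pair*
if it is a concatenation of two palindromes. -/
def PalPair (w : List Bool) : Prop :=
  ∃ p q : List Bool, p.Palindrome ∧ q.Palindrome ∧ w = p ++ q

/-- `u` is a proper factor of `w`: a factor (contiguous subword) other than
`w` itself. -/
def ProperFactor (u w : List Bool) : Prop :=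
  u <:+: w ∧ u ≠ w

/-- A *minimal non palindrome pair*: a word that is not a palindrome pair but
all of whose proper factors are palindrome pairs. -/
def MNPP (w : List Bool) : Prop :=
  ¬ PalPair w ∧ ∀ u, ProperFactor u w → PalPair u

/-- `IsBlock w c m` says that `w` has a block (maximal run) of the letter `c`
of length `m`: an occurrence of `c^m` that cannot be extended on either side. -/
def IsBlock (w : List Bool) (c : Bool) (m : ℕ) : Prop :=
  0 < m ∧ ∃ p s : List Bool, w = p ++ List.replicate m c ++ s ∧
    p.getLast? ≠ some c ∧ s.head? ≠ some c

/-- `w` has an *internal maximum block*: a block that is neither the first nor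
last block of `w` (so it is flanked on both sides by the other letter) and
whose length is at least that of every block of `w`. -/
def HasInternalMaxBlock (w : List Bool) : Prop :=
  ∃ (c : Bool) (m : ℕ) (u v : List Bool), 0 < m ∧
    w = u ++ List.replicate m c ++ v ∧
    u.getLast? = some (!c) ∧ v.head? = some (!c) ∧
    ∀ c' m', IsBlock w c' m' → m' ≤ m

/-- The word `d^p c^q d^s c^t d^r`. -/
def fiveBlocks (d c : Bool) (p q s t r : ℕ) : List Bool :=
  List.replicate p d ++ (List.replicate q c ++ (List.replicate s d ++
    (List.replicate t c ++ List.replicate r d)))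

/-- A word is a palindrome pair iff it is conjugate to its reversal. -/
theorem palPair_iff_isRotated_reverse (w : List Bool) : PalPair w ↔ w.reverse ~r w := by
  constructor
  · rintro ⟨p, q, hp, hq, rfl⟩
    rw [List.reverse_append, hp.reverse_eq, hq.reverse_eq]
    exact List.isRotated_append
  · intro h
    obtain ⟨n, hn, h⟩ := List.isRotated_iff_mod.1 h.symm
    rw [List.rotate_eq_drop_append_take hn] at h
    have h' : w.drop n ++ w.take n = (w.drop n).reverse ++ (w.take n).reverse := by
      rw [← List.reverse_append, List.take_append_drop, h]
    obtain ⟨h1, h2⟩ := List.append_inj h' (by simp)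
    exact ⟨_, _, .of_reverse_eq h2.symm, .of_reverse_eq h1.symm,
      (List.take_append_drop n w).symm⟩

theorem PalPair.of_isRotated {w w' : List Bool} (h : PalPair w) (hr : w ~r w') : PalPair w' := by
  rw [palPair_iff_isRotated_reverse] at h ⊢
  exact (hr.symm.reverse.trans h).trans hr

theorem palPair_reverse_iff (w : List Bool) : PalPair w.reverse ↔ PalPair w := by
  rw [palPair_iff_isRotated_reverse, palPair_iff_isRotated_reverse, List.reverse_reverse]
  exact List.isRotated_comm

theorem MNPP.reverse {w : List Bool} (h : MNPP w) : MNPP w.reverse := by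
  refine ⟨fun hp => h.1 ((palPair_reverse_iff w).1 hp), fun u ⟨hu, hne⟩ => ?_⟩
  rw [← palPair_reverse_iff]
  refine h.2 _ ⟨List.reverse_infix.1 (by simpa using hu), fun he => hne ?_⟩
  rw [← he, List.reverse_reverse]

theorem MNPP.eq_of_factor {w u : List Bool} (h : MNPP w) (hu : u <:+: w) (hn : ¬ PalPair u) :
    u = w := by
  by_contra hne
  exact hn (h.2 u ⟨hu, hne⟩)

theorem MNPP.eq_nil_of_not_palPair {x u y : List Bool} (h : MNPP (x ++ u ++ y))
    (hn : ¬ PalPair u) : x = [] ∧ y = [] := by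
  have := congrArg List.length (h.eq_of_factor ⟨x, y, rfl⟩ hn)
  simp only [List.length_append] at this
  exact ⟨List.length_eq_zero_iff.1 (by omega), List.length_eq_zero_iff.1 (by omega)⟩

theorem palindrome_replicate (n : ℕ) (a : Bool) : (List.replicate n a).Palindrome :=
  .of_reverse_eq (List.reverse_replicate ..)

theorem palPair_replicate_append (p q : ℕ) (d c : Bool) :
    PalPair (List.replicate p d ++ List.replicate q c) :=
  ⟨_, _, palindrome_replicate p d, palindrome_replicate q c, rfl⟩

theorem fiveBlocks_isRotated (d c : Bool) (p q s t r : ℕ) :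
    fiveBlocks d c (r + p) q s t 0 ~r fiveBlocks d c p q s t r := by
  have := List.isRotated_append (l := List.replicate r d) (l' := fiveBlocks d c p q s t 0)
  simpa [fiveBlocks, ← List.append_assoc, ← List.replicate_add] using this

theorem palPair_fiveBlocks {d c : Bool} {p q s t r : ℕ}
    (h : p + r = s ∨ q = t ∨ p + r = 0 ∨ q = 0 ∨ s = 0 ∨ t = 0) :
    PalPair (fiveBlocks d c p q s t r) := by
  refine PalPair.of_isRotated ?_ (fiveBlocks_isRotated d c p q s t r)
  rw [Nat.add_comm r p]
  generalize p + r = n at h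
  rcases h with rfl | rfl | rfl | rfl | rfl | rfl
  · exact ⟨List.replicate n d ++ (List.replicate q c ++ List.replicate n d), List.replicate t c,
      .of_reverse_eq (by simp), palindrome_replicate _ _, by simp [fiveBlocks]⟩
  · exact ⟨List.replicate n d, List.replicate q c ++ (List.replicate s d ++ List.replicate q c),
      palindrome_replicate _ _, .of_reverse_eq (by simp), by simp [fiveBlocks]⟩
  · refine (palPair_replicate_append (t + q) s c d).of_isRotated ?_
    simpa [fiveBlocks, List.replicate_add, -List.replicate_append_replicate] using List.isRotated_append (l := List.replicate t c)
      (l' := List.replicate q c ++ List.replicate s d)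
  · simpa [fiveBlocks, List.replicate_add, -List.replicate_append_replicate] using palPair_replicate_append (n + s) t d c
  · simpa [fiveBlocks, List.replicate_add, -List.replicate_append_replicate] using palPair_replicate_append n (q + t) d c
  · refine (palPair_replicate_append (s + n) q d c).of_isRotated ?_
    simpa [fiveBlocks, List.replicate_add, -List.replicate_append_replicate] using List.isRotated_append (l := List.replicate s d)
      (l' := List.replicate n d ++ List.replicate q c)

theorem replicate_append_cons_inj {d c : Bool} (hdc : d ≠ c) {p s : ℕ} {x y : List Bool}
    (h : List.replicate p d ++ c :: x = List.replicate s d ++ c :: y) : p = s ∧ x = y := by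
  induction p generalizing s with
  | zero => cases s <;> simp_all [List.replicate_succ, eq_comm]
  | succ p ih =>
    cases s with
    | zero => simp_all [List.replicate_succ]
    | succ s => simpa using ih (by simpa [List.replicate_succ] using h)

theorem not_palPair_fiveBlocks {d c : Bool} (hdc : d ≠ c) {p q s t r : ℕ}
    (hp : 0 < p + r) (hq : 0 < q) (hs : 0 < s) (ht : 0 < t) (hps : p + r ≠ s) (hqt : q ≠ t) :
    ¬ PalPair (fiveBlocks d c p q s t r) := by
  intro h
  replace h := h.of_isRotated (fiveBlocks_isRotated d c p q s t r).symm
  rw [Nat.add_comm r p] at h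
  generalize p + r = n at *
  obtain ⟨n, rfl⟩ := Nat.exists_eq_succ_of_ne_zero hp.ne'
  obtain ⟨q, rfl⟩ := Nat.exists_eq_succ_of_ne_zero hq.ne'
  obtain ⟨s, rfl⟩ := Nat.exists_eq_succ_of_ne_zero hs.ne'
  obtain ⟨t, rfl⟩ := Nat.exists_eq_succ_of_ne_zero ht.ne'
  rw [palPair_iff_isRotated_reverse] at h
  have h2 : fiveBlocks d c (n + 1) (q + 1) (s + 1) (t + 1) 0 ~r
      fiveBlocks d c (n + 1) (t + 1) (s + 1) (q + 1) 0 := by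
    refine h.symm.trans ?_
    have := List.isRotated_append (l := List.replicate (t + 1) c ++ (List.replicate (s + 1) d ++
      List.replicate (q + 1) c)) (l' := List.replicate (n + 1) d)
    simpa [fiveBlocks] using this
  obtain ⟨i, hi, h2⟩ := List.isRotated_iff_mod.1 h2
  rw [List.rotate_eq_drop_append_take hi] at h2
  have h3 := List.take_append_drop i (fiveBlocks d c (n + 1) (q + 1) (s + 1) (t + 1) 0)
  generalize List.take i _ = x at h2 h3
  generalize List.drop i _ = y at h2 h3
  have hyc : y.head? ≠ some c := by
    intro hy
    have := congrArg List.head? h2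
    simp [fiveBlocks, List.head?_append, hy, List.replicate_succ] at this
    exact hdc this.symm
  have hxd : x.getLast? ≠ some d := by
    intro hx
    have := congrArg List.getLast? h2
    simp [fiveBlocks, List.getLast?_append, hx, List.getLast?_replicate] at this
    exact hdc this
  have hqt' : fiveBlocks d c (n + 1) (q + 1) (s + 1) (t + 1) 0 ≠
      fiveBlocks d c (n + 1) (t + 1) (s + 1) (q + 1) 0 := by
    intro he
    have := (replicate_append_cons_inj hdc.symm (by simpa [fiveBlocks, List.replicate_succ,
      replicate_append_cons_inj] using List.append_cancel_left he)).1
    omega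
  have hps' : ¬ (x = List.replicate (n + 1) d ++ List.replicate (q + 1) c ∧
      y = List.replicate (s + 1) d ++ List.replicate (t + 1) c) := by
    rintro ⟨rfl, rfl⟩
    have := (replicate_append_cons_inj hdc (by simpa [fiveBlocks, List.replicate_succ] using h2)).1
    omega
  rcases List.append_eq_append_iff.1 h3 with ⟨a, ha, rfl⟩ | ⟨b, rfl, hb⟩
  · obtain ⟨-, hx, -⟩ := List.replicate_eq_append_iff.1 ha
    rw [hx, List.getLast?_replicate] at hxd
    have : x = [] := by simpa using hxd
    subst this
    exact hqt' (by simpa [← h3] using h2)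
  rcases List.append_eq_append_iff.1 hb.symm with ⟨a, ha, rfl⟩ | ⟨b, rfl, hb₂⟩
  · obtain ⟨-, hx, hy⟩ := List.replicate_eq_append_iff.1 ha
    rw [hy, List.head?_append, List.head?_replicate] at hyc
    have : a = [] := by by_contra h0; simp [h0] at hyc
    subst this
    rw [List.append_nil] at ha
    exact hps' ⟨by rw [ha], by simp⟩
  rcases List.append_eq_append_iff.1 hb₂.symm with ⟨a, ha, rfl⟩ | ⟨b, rfl, hb₃⟩
  · obtain ⟨-, hx, hy⟩ := List.replicate_eq_append_iff.1 ha
    rw [hx, ← List.append_assoc, List.getLast?_append, List.getLast?_replicate] at hxd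
    have : b = [] := by by_contra h0; simp [h0] at hxd
    subst this
    rw [List.nil_append] at ha
    exact hps' ⟨by simp, by simp [ha]⟩
  · have hb' : List.replicate (t + 1) c = b ++ y := by simpa using hb₃
    obtain ⟨-, hx, hy⟩ := List.replicate_eq_append_iff.1 hb'
    rw [hy, List.head?_replicate] at hyc
    have : y = [] := by simpa using hyc
    subst this
    exact hqt' (by rw [← h3, ← h2]; simp)

/-- In a factor of a word with at most five blocks, an interior block that is cut on the left
(resp. right) is preceded (resp. followed) by empty blocks only. -/
theorem infix_fiveBlocks {d c : Bool} {p q s t r : ℕ} {u : List Bool}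
    (h : u <:+: fiveBlocks d c p q s t r) :
    ∃ p' q' s' t' r', u = fiveBlocks d c p' q' s' t' r' ∧
      p' ≤ p ∧ q' ≤ q ∧ s' ≤ s ∧ t' ≤ t ∧ r' ≤ r ∧
      (q' = q ∨ p' = 0 ∨ s' + t' + r' = 0) ∧
      (s' = s ∨ p' + q' = 0 ∨ t' + r' = 0) ∧
      (t' = t ∨ p' + q' + s' = 0 ∨ r' = 0) := by
  obtain ⟨v, hpre, hsuf⟩ := List.infix_iff_prefix_suffix.1 h
  have hv := List.suffix_iff_eq_drop.1 hsuf
  have hu := List.prefix_iff_eq_take.1 hpre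
  generalize (fiveBlocks d c p q s t r).length - v.length = a at hv
  generalize u.length = b at hu
  simp only [fiveBlocks, List.drop_append, List.drop_replicate, List.length_replicate] at hv
  obtain ⟨p₁, q₁, s₁, t₁, r₁, hv, h₁⟩ : ∃ p' q' s' t' r', v = fiveBlocks d c p' q' s' t' r' ∧
      p' ≤ p ∧ q' ≤ q ∧ s' ≤ s ∧ t' ≤ t ∧ r' ≤ r ∧
      (q' = q ∨ p' = 0) ∧ (s' = s ∨ p' + q' = 0) ∧ (t' = t ∨ p' + q' + s' = 0) := by
    refine ⟨_, _, _, _, _, hv, ?_⟩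
    omega
  rw [hv] at hu
  simp only [fiveBlocks, List.take_append, List.take_replicate, List.length_replicate] at hu
  obtain ⟨p₂, q₂, s₂, t₂, r₂, hu, h₂⟩ : ∃ p' q' s' t' r', u = fiveBlocks d c p' q' s' t' r' ∧
      p' ≤ p₁ ∧ q' ≤ q₁ ∧ s' ≤ s₁ ∧ t' ≤ t₁ ∧ r' ≤ r₁ ∧
      (q' = q₁ ∨ s' + t' + r' = 0) ∧ (s' = s₁ ∨ t' + r' = 0) ∧ (t' = t₁ ∨ r' = 0) := by
    refine ⟨_, _, _, _, _, hu, ?_⟩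
    omega
  exact ⟨p₂, q₂, s₂, t₂, r₂, hu, by omega⟩

theorem mnpp_fiveBlocks_of_single_ends {d c : Bool} (hdc : d ≠ c) {a b : ℕ} (ha : 2 ≤ a) (hb : 2 ≤ b) :
    MNPP (fiveBlocks d c 1 a b 1 0) := by
  refine ⟨not_palPair_fiveBlocks hdc (by omega) (by omega) (by omega) (by omega) (by omega)
    (by omega), fun u ⟨hu, hne⟩ => ?_⟩
  obtain ⟨p, q, s, t, r, rfl, h⟩ := infix_fiveBlocks hu
  refine palPair_fiveBlocks ?_
  have : ¬ (p = 1 ∧ q = a ∧ s = b ∧ t = 1 ∧ r = 0) := by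
    rintro ⟨rfl, rfl, rfl, rfl, rfl⟩
    exact hne rfl
  omega

theorem mnpp_fiveBlocks_of_single_outer {d c : Bool} (hdc : d ≠ c) {a b : ℕ} (ha : 1 ≤ a)
    (hb : 1 ≤ b) (hab : a ≠ b) : MNPP (fiveBlocks d c 1 a 1 b 1) := by
  refine ⟨not_palPair_fiveBlocks hdc (by omega) (by omega) (by omega) (by omega) (by omega)
    (by omega), fun u ⟨hu, hne⟩ => ?_⟩
  obtain ⟨p, q, s, t, r, rfl, h⟩ := infix_fiveBlocks hu
  refine palPair_fiveBlocks ?_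
  have : ¬ (p = 1 ∧ q = a ∧ s = 1 ∧ t = b ∧ r = 1) := by
    rintro ⟨rfl, rfl, rfl, rfl, rfl⟩
    exact hne rfl
  omega

theorem mnpp_fiveBlocks_of_double_end {d c : Bool} (hdc : d ≠ c) {a : ℕ} (ha : 2 ≤ a) :
    MNPP (fiveBlocks d c 1 1 a 2 0) := by
  refine ⟨not_palPair_fiveBlocks hdc (by omega) (by omega) (by omega) (by omega) (by omega)
    (by omega), fun u ⟨hu, hne⟩ => ?_⟩
  obtain ⟨p, q, s, t, r, rfl, h⟩ := infix_fiveBlocks hu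
  refine palPair_fiveBlocks ?_
  have : ¬ (p = 1 ∧ q = 1 ∧ s = a ∧ t = 2 ∧ r = 0) := by
    rintro ⟨rfl, rfl, rfl, rfl, rfl⟩
    exact hne rfl
  omega

/-- Either `w` is a minimal non palindrome pair, or it has the form `d e^n d e^n d` with `e` the
letter other than `d`. -/
def MNPPOrSpecial (w : List Bool) : Prop :=
  MNPP w ∨ ∃ n d, 1 ≤ n ∧ w = fiveBlocks d (!d) 1 n 1 n 1

theorem MNPPOrSpecial.reverse {w : List Bool} (h : MNPPOrSpecial w) :
    MNPPOrSpecial w.reverse := by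
  rcases h with h | ⟨n, d, hn, rfl⟩
  · exact .inl h.reverse
  · exact .inr ⟨n, d, hn, by simp [fiveBlocks]⟩

theorem exists_leading_run {d c : Bool} (hdc : d ≠ c) (l : List Bool) :
    ∃ i, l = List.replicate i c ∨ ∃ l', l = List.replicate i c ++ d :: l' := by
  induction l with
  | nil => exact ⟨0, .inl rfl⟩
  | cons a l ih =>
    by_cases ha : a = c
    · subst ha
      obtain ⟨i, rfl | ⟨l', rfl⟩⟩ := ih
      · exact ⟨i + 1, .inl (by simp [List.replicate_succ])⟩
      · exact ⟨i + 1, .inr ⟨l', by simp [List.replicate_succ]⟩⟩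
    · refine ⟨0, .inr ⟨l, ?_⟩⟩
      have : a = d := by revert ha hdc; cases a <;> cases c <;> cases d <;> simp
      simp [this]

theorem exists_trailing_run {d c : Bool} (hdc : d ≠ c) (l : List Bool) :
    ∃ i, l = List.replicate i c ∨ ∃ l', l = l' ++ d :: List.replicate i c := by
  obtain ⟨i, h | ⟨l', h⟩⟩ := exists_leading_run hdc l.reverse
  · exact ⟨i, .inl (by simpa using congrArg List.reverse h)⟩
  · exact ⟨i, .inr ⟨l'.reverse, by simpa using congrArg List.reverse h⟩⟩

theorem exists_isBlock_of_run {w : List Bool} {c : Bool} {n : ℕ} (hn : 0 < n)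
    (h : List.replicate n c <:+: w) : ∃ n', n ≤ n' ∧ IsBlock w c n' := by
  obtain ⟨x, y, rfl⟩ := h
  have key (l : List Bool) : ∃ i l', l = List.replicate i c ++ l' ∧ l'.head? ≠ some c := by
    obtain ⟨i, h | ⟨l', h⟩⟩ := exists_leading_run (Bool.not_ne_self c) l
    · exact ⟨i, [], by simpa using h, by simp⟩
    · exact ⟨i, _, h, by simp⟩
  obtain ⟨i, x', hx, hx'⟩ := key x.reverse
  obtain ⟨j, y', rfl, hy'⟩ := key y
  obtain rfl : x = x'.reverse ++ List.replicate i c := by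
    simpa using congrArg List.reverse hx
  refine ⟨i + n + j, by omega, by omega, x'.reverse, y', ?_, by simpa using hx', hy'⟩
  simp [List.replicate_add, -List.replicate_append_replicate]

/-- The word `(c^m d)^r`. -/
def runPower (d c : Bool) (m r : ℕ) : List Bool :=
  (List.replicate r (List.replicate m c ++ [d])).flatten

theorem runPower_succ (d c : Bool) (m r : ℕ) :
    runPower d c m (r + 1) = List.replicate m c ++ d :: runPower d c m r := by
  simp [runPower, List.replicate_succ]

theorem runPower_succ' (d c : Bool) (m r : ℕ) :
    runPower d c m (r + 1) = runPower d c m r ++ (List.replicate m c ++ [d]) := by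
  simp [runPower, List.replicate_succ']

theorem reverse_runPower (d c : Bool) (m r : ℕ) :
    (runPower d c m r).reverse ++ [d] = d :: runPower d c m r := by
  induction r with
  | zero => simp [runPower]
  | succ r ih =>
    conv_lhs => rw [runPower_succ']
    rw [runPower_succ]
    simp [ih]

theorem palindrome_cons_runPower (d c : Bool) (m r : ℕ) :
    (d :: runPower d c m r).Palindrome :=
  .of_reverse_eq (by simp [reverse_runPower])

theorem exists_runPower_decomposition {d c : Bool} (hdc : d ≠ c) (m : ℕ) (y : List Bool)
    (hy : ¬ List.replicate (m + 1) c <:+: y) :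
    ∃ r k, (k ≤ m ∧ y = runPower d c m r ++ List.replicate k c) ∨
      (k < m ∧ ∃ y', y = runPower d c m r ++ (List.replicate k c ++ d :: y')) := by
  induction hl : y.length using Nat.strong_induction_on generalizing y with
  | _ l ih =>
    subst hl
    obtain ⟨k, h⟩ := exists_leading_run hdc y
    have hk : k ≤ m := by
      by_contra hk
      refine hy (List.IsInfix.trans ?_ (List.IsPrefix.isInfix (l₁ := List.replicate k c) ?_))
      · exact List.infix_replicate_iff.2 ⟨by simp; omega, by simp⟩
      · rcases h with rfl | ⟨y', rfl⟩ <;> simp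
    rcases h with rfl | ⟨y', rfl⟩
    · exact ⟨0, k, .inl ⟨hk, by simp [runPower]⟩⟩
    rcases hk.lt_or_eq with hk | rfl
    · exact ⟨0, k, .inr ⟨hk, y', by simp [runPower]⟩⟩
    obtain ⟨r, j, h⟩ := ih y'.length (by simp; omega) y'
      (fun h => hy (h.trans ⟨List.replicate k c ++ [d], [], by simp⟩)) rfl
    refine ⟨r + 1, j, ?_⟩
    rcases h with ⟨hj, rfl⟩ | ⟨hj, y'', rfl⟩
    · exact .inl ⟨hj, by simp [runPower_succ]⟩
    · exact .inr ⟨hj, y'', by simp [runPower_succ]⟩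

theorem exists_append_of_runPower (d c : Bool) {m : ℕ} (hm : 0 < m) (r : ℕ) :
    ∃ z, List.replicate m c ++ d :: runPower d c m r = z ++ [c, d] := by
  obtain ⟨m, rfl⟩ := Nat.exists_eq_succ_of_ne_zero hm.ne'
  cases r with
  | zero => exact ⟨List.replicate m c, by simp [runPower, List.replicate_succ']⟩
  | succ r =>
    rw [← runPower_succ, runPower_succ']
    exact ⟨runPower d c (m + 1) (r + 1) ++ List.replicate m c, by simp [List.replicate_succ']⟩

/-- The deletion statement when the word to the right of the maximum block `c^m` is not
of the form `d (c^m d)^r c^k`. -/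
theorem delete_of_right {d c : Bool} (hdc : d ≠ c) {m r k : ℕ} {x y : List Bool}
    (h : MNPP (x ++ d :: (List.replicate m c ++
      d :: (runPower d c m r ++ (List.replicate k c ++ d :: y)))))
    (hlen : 7 ≤ (x ++ d :: (List.replicate m c ++
      d :: (runPower d c m r ++ (List.replicate k c ++ d :: y)))).length)
    (hmax : ∀ e n, List.replicate n e <:+: x ++ d :: (List.replicate m c ++
      d :: (runPower d c m r ++ (List.replicate k c ++ d :: y))) → n ≤ m) (hk : k < m) :
    MNPPOrSpecial (x ++ d :: (List.replicate (m - 1) c ++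
      d :: (runPower d c m r ++ (List.replicate k c ++ d :: y)))) := by
  have hB (hk0 : 0 < k) : ¬ PalPair (fiveBlocks d c 1 m 1 k 1) :=
    not_palPair_fiveBlocks hdc (by omega) (by omega) (by omega) (by omega) (by omega) (by omega)
  have hm2 (hk0 : k = 0) : 2 ≤ m := by
    refine hmax d 2 ?_
    subst hk0
    rcases r with _ | r
    · exact ⟨x ++ d :: List.replicate m c, y, by simp [runPower, List.replicate_succ]⟩
    · exact ⟨x ++ d :: (List.replicate m c ++ d :: (runPower d c m r ++ List.replicate m c)), y,
        by simp [runPower_succ', List.replicate_succ]⟩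
  have hA (hk0 : k = 0) : ¬ PalPair (fiveBlocks c d 1 1 m 2 0) :=
    have := hm2 hk0
    not_palPair_fiveBlocks hdc.symm (by omega) (by omega) (by omega) (by omega) (by omega)
      (by omega)
  rcases r with _ | r
  swap
  · exfalso
    obtain ⟨z, hz⟩ := exists_append_of_runPower d c (m := m) (by omega) r
    have hw : x ++ d :: (List.replicate m c ++
        d :: (runPower d c m (r + 1) ++ (List.replicate k c ++ d :: y))) =
        x ++ d :: ((List.replicate m c ++ d :: runPower d c m r) ++
          (List.replicate m c ++ d :: (List.replicate k c ++ d :: y))) := by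
      simp [runPower_succ']
    rw [hw, hz] at h
    rcases Nat.eq_zero_or_pos k with rfl | hk0
    · have := MNPP.eq_nil_of_not_palPair (x := x ++ d :: z) (y := y)
        (by simpa [fiveBlocks, List.replicate_succ] using h) (hA rfl)
      simp at this
    · have := MNPP.eq_nil_of_not_palPair (x := x ++ d :: (z ++ [c])) (y := y)
        (by simpa [fiveBlocks, List.replicate_succ] using h) (hB hk0)
      simp at this
  simp only [runPower, List.replicate_zero, List.flatten_nil, List.nil_append] at h hlen hmax ⊢
  rcases Nat.eq_zero_or_pos k with rfl | hk0
  swap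
  · obtain ⟨rfl, rfl⟩ := MNPP.eq_nil_of_not_palPair (x := x) (y := y)
      (by simpa [fiveBlocks, List.replicate_succ] using h) (hB hk0)
    by_cases hkm : m - 1 = k
    · refine .inr ⟨k, d, hk0, ?_⟩
      have : (!d) = c := by revert hdc; cases d <;> cases c <;> simp
      simp [fiveBlocks, hkm, this]
    · refine .inl ?_
      simpa [fiveBlocks] using
        mnpp_fiveBlocks_of_single_outer hdc (a := m - 1) (b := k) (by omega) (by omega) hkm
  specialize hm2 rfl
  specialize hA rfl
  simp only [List.replicate_zero, List.nil_append] at h hlen hmax ⊢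
  obtain ⟨i, rfl | ⟨y, rfl⟩⟩ := exists_leading_run hdc.symm y
  swap
  · obtain ⟨rfl, rfl⟩ := MNPP.eq_nil_of_not_palPair (x := x) (y := y)
      (u := fiveBlocks d c 1 m (i + 2) 1 0)
      (by simpa [fiveBlocks, List.replicate_succ] using h)
      (not_palPair_fiveBlocks hdc (by omega) (by omega) (by omega) (by omega) (by omega)
        (by omega))
    have := hmax d (i + 2) ⟨d :: List.replicate m c, [c], by simp [List.replicate_succ]⟩
    simp at hlen
    refine .inl ?_
    simpa [fiveBlocks, List.replicate_succ] using
      mnpp_fiveBlocks_of_single_ends hdc (a := m - 1) (b := i + 2) (by omega) (by omega)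
  obtain ⟨j, rfl | ⟨x, rfl⟩⟩ := exists_trailing_run hdc.symm x
  · refine absurd ?_ h.1
    have := palPair_fiveBlocks (d := d) (c := c) (p := j + 1) (q := m) (s := i + 2) (t := 0)
      (r := 0) (by simp)
    rw [List.append_cons, ← List.replicate_succ']
    simpa [fiveBlocks, List.replicate_succ (n := i), List.replicate_succ (n := i + 1)] using this
  rcases j with _ | j
  · obtain ⟨rfl, hi⟩ := MNPP.eq_nil_of_not_palPair (x := x) (y := List.replicate i d)
      (by simpa [fiveBlocks, List.replicate_succ] using h) hA
    obtain rfl : i = 0 := by simpa using hi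
    simp at hlen
    refine .inl ?_
    simpa [fiveBlocks, List.replicate_succ] using
      mnpp_fiveBlocks_of_double_end hdc.symm (a := m - 1) (by omega)
  · have hj : List.replicate (j + 1) d ++ d :: (List.replicate m c ++ d :: d :: List.replicate i d)
        = List.replicate (j + 2) d ++ (List.replicate m c ++ d :: d :: List.replicate i d) := by
      rw [List.replicate_succ' (n := j + 1)]
      simp
    have := MNPP.eq_nil_of_not_palPair (x := x) (y := d :: List.replicate i d)
      (u := fiveBlocks c d 1 (j + 2) m 1 0)
      (by simpa [fiveBlocks, hj] using h)
      (not_palPair_fiveBlocks hdc.symm (by omega) (by omega) (by omega) (by omega) (by omega)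
        (by omega))
    simp at this

/-- Words `c^l (d c^m)^r d c^k` are palindrome pairs. -/
theorem palPair_runPower (d c : Bool) (l m r k : ℕ) :
    PalPair (List.replicate l c ++ ((d :: runPower d c m r) ++ List.replicate k c)) := by
  refine PalPair.of_isRotated ⟨_, _, palindrome_cons_runPower d c m r,
    palindrome_replicate (k + l) c, rfl⟩ ?_
  simpa [List.replicate_add, -List.replicate_append_replicate] using
    List.isRotated_append (l := (d :: runPower d c m r) ++ List.replicate k c)
      (l' := List.replicate l c)

theorem runPower_add (d c : Bool) (m r s : ℕ) :
    runPower d c m (r + s) = runPower d c m r ++ runPower d c m s := by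
  simp [runPower, List.replicate_add, -List.replicate_append_replicate]

theorem mnppOrSpecial_of_delete {d c : Bool} (hdc : d ≠ c) {m : ℕ} {x y : List Bool}
    (h : MNPP (x ++ d :: (List.replicate m c ++ d :: y)))
    (hlen : 7 ≤ (x ++ d :: (List.replicate m c ++ d :: y)).length)
    (hmax : ∀ e n, List.replicate n e <:+: x ++ d :: (List.replicate m c ++ d :: y) → n ≤ m) :
    MNPPOrSpecial (x ++ d :: (List.replicate (m - 1) c ++ d :: y)) := by
  have hy : ¬ List.replicate (m + 1) c <:+: y := fun hy => by
    have := hmax _ _ (hy.trans ⟨x ++ d :: (List.replicate m c ++ [d]), [], by simp⟩)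
    omega
  have hx : ¬ List.replicate (m + 1) c <:+: x.reverse := fun hx => by
    have hx := List.reverse_infix.2 hx
    rw [List.reverse_replicate, List.reverse_reverse] at hx
    have := hmax _ _ (hx.trans List.infix_append_left)
    omega
  obtain ⟨r, k, ⟨-, hy⟩ | ⟨hk, y', rfl⟩⟩ := exists_runPower_decomposition hdc m y hy
  swap
  · exact delete_of_right hdc h hlen hmax hk
  obtain ⟨s, l, ⟨-, hx⟩ | ⟨hl, x', hx⟩⟩ := exists_runPower_decomposition hdc m x.reverse hx
  swap
  · have hrev (n : ℕ) : (x ++ d :: (List.replicate n c ++ d :: y)).reverse =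
        y.reverse ++ d :: (List.replicate n c ++
          d :: (runPower d c m s ++ (List.replicate l c ++ d :: x'))) := by
      simp [hx]
    rw [← List.reverse_reverse (_ ++ _)]
    refine MNPPOrSpecial.reverse ?_
    rw [hrev]
    refine delete_of_right hdc ?_ ?_ ?_ hl
    · rw [← hrev]
      exact h.reverse
    · rw [← hrev, List.length_reverse]
      exact hlen
    · intro e n he
      rw [← hrev] at he
      exact hmax e n (by simpa using List.reverse_infix.2 he)
  refine absurd ?_ h.1
  have hx : x = List.replicate l c ++ (runPower d c m s).reverse := by
    simpa using congrArg List.reverse hx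
  subst hx hy
  have := palPair_runPower d c l m (s + (r + 1)) k
  rw [runPower_add, runPower_succ, ← List.cons_append, ← reverse_runPower] at this
  simpa using this

/-- Deleting one letter from an internal maximum block of a minimal non
palindrome pair of length at least 7 yields either a minimal non palindrome
pair or a word of the form `0 1^n 0 1^n 0` or `1 0^n 1 0^n 1` with `n ≥ 1`. -/
theorem mnpp_delete_from_internal_max_block (w' : List Bool) (hw' : MNPP w')
    (hlen : 7 ≤ w'.length)
    (c : Bool) (m : ℕ) (u v : List Bool) (hm : 0 < m)
    (hdecomp : w' = u ++ List.replicate m c ++ v)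
    (hu : u.getLast? = some (!c)) (hv : v.head? = some (!c))
    (hmax : ∀ c' m', IsBlock w' c' m' → m' ≤ m)
    (w : List Bool) (hw : w = u ++ List.replicate (m - 1) c ++ v) :
    MNPP w ∨
      ∃ n : ℕ, 1 ≤ n ∧
        (w = [false] ++ List.replicate n true ++ [false] ++
               List.replicate n true ++ [false] ∨
         w = [true] ++ List.replicate n false ++ [true] ++
               List.replicate n false ++ [true]) := by
  obtain ⟨x, rfl⟩ := List.getLast?_eq_some_iff.1 hu
  obtain ⟨y, rfl⟩ := List.head?_eq_some_iff.1 hv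
  subst hdecomp hw
  have := mnppOrSpecial_of_delete (Bool.not_ne_self c) (by simpa using hw')
    (by simpa using hlen) (m := m) fun e n he => by
      rcases Nat.eq_zero_or_pos n with rfl | hn
      · exact Nat.zero_le m
      obtain ⟨n', hn', hb⟩ := exists_isBlock_of_run hn he
      exact hn'.trans (hmax e n' (by simpa using hb))
  rcases this with h | ⟨n, d, hn, h⟩
  · exact .inl (by simpa using h)
  · refine .inr ⟨n, hn, ?_⟩
    cases d
    · exact .inl (by simpa [fiveBlocks] using h)
    · exact .inr (by simpa [fiveBlocks] using h)
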